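/- There exists a simple polygon P with a triangulation T_P that has exactly k = 3 flippable diagonals, of which l = 2 form a ps-flippable set, such that P has exactly 5 = 2² · (5/4)¹ triangulations; consequently, the constant c_gon (the largest real number such that every simple polygon with a triangulation having k flippable diagonals, l of which form a ps-flippable set, has at least 2^l · c_gon^{k−l} triangulations) satisfies c_gon ≤ 5/4. -/

import Mathlib

open scoped Classical

noncomputable section

abbrev Pt : Type := ℝ × ℝ

/-- The closed straight segment spanned by an unordered pair of points. -/
def seg2 (e : Sym2 Pt) : Set Pt :=
  Sym2.lift ⟨fun p q => segment ℝ p q, fun p q => segment_symm ℝ p q⟩ e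

/-- A finite set of points is in (strictly) convex position. -/
def InConvexPosition (Q : Finset Pt) : Prop :=
  ∀ p ∈ Q, p ∉ convexHull ℝ (↑(Q.erase p) : Set Pt)

/-- `p q` is an edge of the convex hull boundary of `Q`. -/
def IsHullEdgeOf (Q : Finset Pt) (p q : Pt) : Prop :=
  p ∈ Q ∧ q ∈ Q ∧ p ≠ q ∧
    segment ℝ p q ⊆ frontier (convexHull ℝ (Q : Set Pt))

/-- `e` is a diagonal of the convex polygon with vertex set `Q`. -/
def IsDiagonalOf (Q : Finset Pt) (e : Sym2 Pt) : Prop :=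
  ∃ p ∈ Q, ∃ q ∈ Q, e = s(p, q) ∧
    openSegment ℝ p q ⊆ interior (convexHull ℝ (Q : Set Pt))

/-- A simple polygon in the plane (with vertices in general position),
given by the cyclic sequence of its vertices; consecutive boundary edges meet
only at shared endpoints, so the boundary is a simple closed polygonal curve. -/
structure SimplePolygon where
  n : ℕ
  three_le : 3 ≤ n
  vtx : Fin n → Pt
  inj : Function.Injective vtx
  genpos : ∀ i j k : Fin n, i ≠ j → i ≠ k → j ≠ k →
    ¬ Collinear ℝ ({vtx i, vtx j, vtx k} : Set Pt)
  noncrossing : ∀ i j : Fin n,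
    s(vtx i, vtx (finRotate n i)) ≠ s(vtx j, vtx (finRotate n j)) →
    ∀ x ∈ segment ℝ (vtx i) (vtx (finRotate n i)) ∩
          segment ℝ (vtx j) (vtx (finRotate n j)),
      x ∈ s(vtx i, vtx (finRotate n i)) ∧ x ∈ s(vtx j, vtx (finRotate n j))

/-- The boundary of the polygon. -/
def SimplePolygon.boundary (P : SimplePolygon) : Set Pt :=
  ⋃ i : Fin P.n, segment ℝ (P.vtx i) (P.vtx (finRotate P.n i))

/-- The open region inside the polygon: the union of the bounded connected
components of the complement of the boundary. -/
def SimplePolygon.inside (P : SimplePolygon) : Set Pt :=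
  {x | x ∉ P.boundary ∧ Bornology.IsBounded (connectedComponentIn P.boundaryᶜ x)}

def SimplePolygon.IsVtx (P : SimplePolygon) (p : Pt) : Prop :=
  ∃ i, p = P.vtx i

def SimplePolygon.IsBoundaryEdge (P : SimplePolygon) (e : Sym2 Pt) : Prop :=
  ∃ i, e = s(P.vtx i, P.vtx (finRotate P.n i))

/-- A diagonal of `P`: a segment between two vertices lying inside `P`. -/
def SimplePolygon.IsDiagonal (P : SimplePolygon) (e : Sym2 Pt) : Prop :=
  ∃ i j : Fin P.n, e = s(P.vtx i, P.vtx j) ∧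
    openSegment ℝ (P.vtx i) (P.vtx j) ⊆ P.inside

/-- A triangulation of a simple polygon: a maximal set of pairwise
non-crossing diagonals. -/
structure PolyTriangulation (P : SimplePolygon) where
  diags : Finset (Sym2 Pt)
  isDiag : ∀ e ∈ diags, P.IsDiagonal e
  noncrossing : ∀ e₁ ∈ diags, ∀ e₂ ∈ diags, e₁ ≠ e₂ →
    ∀ x ∈ seg2 e₁ ∩ seg2 e₂, x ∈ e₁ ∧ x ∈ e₂
  maximal : ∀ e, P.IsDiagonal e →
    (∀ e' ∈ diags, e ≠ e' → ∀ x ∈ seg2 e ∩ seg2 e', x ∈ e ∧ x ∈ e') → e ∈ diags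

/-- The number of triangulations of the polygon `P`. -/
def polyTriCount (P : SimplePolygon) : ℕ := Nat.card (PolyTriangulation P)

def PolyTriangulation.IsEdgeOrDiag {P : SimplePolygon} (D : PolyTriangulation P)
    (e : Sym2 Pt) : Prop :=
  P.IsBoundaryEdge e ∨ e ∈ D.diags

/-- `a b c` span a triangular face of the triangulated polygon. -/
def PolyTriangulation.IsFace {P : SimplePolygon} (D : PolyTriangulation P)
    (a b c : Pt) : Prop :=
  P.IsVtx a ∧ P.IsVtx b ∧ P.IsVtx c ∧
  D.IsEdgeOrDiag s(a, b) ∧ D.IsEdgeOrDiag s(b, c) ∧ D.IsEdgeOrDiag s(a, c) ∧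
  ∀ i, P.vtx i ∉ interior (convexHull ℝ ({a, b, c} : Set Pt))

/-- A diagonal is flippable if its two incident triangles form a convex
quadrilateral (equivalently, the two diagonals of that quadrilateral cross). -/
def PolyTriangulation.IsFlippable {P : SimplePolygon} (D : PolyTriangulation P)
    (e : Sym2 Pt) : Prop :=
  e ∈ D.diags ∧ ∃ a b c d : Pt, e = s(a, b) ∧ c ≠ d ∧
    D.IsFace a b c ∧ D.IsFace a b d ∧
    (openSegment ℝ a b ∩ openSegment ℝ c d).Nonempty

/-- The number of flippable diagonals of a triangulated polygon. -/
def PolyTriangulation.flipCount {P : SimplePolygon} (D : PolyTriangulation P) : ℕ :=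
  (D.diags.filter (fun e => D.IsFlippable e)).card

/-- `F` is a ps-flippable set of diagonals of the triangulated polygon: its
members are diagonals of pairwise interior-disjoint (empty) convex sub-polygons
whose boundary edges belong to the triangulation. -/
def PolyTriangulation.IsPsFlippableSet {P : SimplePolygon} (D : PolyTriangulation P)
    (F : Finset (Sym2 Pt)) : Prop :=
  F ⊆ D.diags ∧
  ∃ 𝒬 : Finset (Finset Pt),
    (∀ Q ∈ 𝒬, (∀ p ∈ Q, P.IsVtx p) ∧ 3 ≤ Q.card ∧ InConvexPosition Q ∧
      (∀ p q, IsHullEdgeOf Q p q → D.IsEdgeOrDiag s(p, q)) ∧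
      (∀ i, P.vtx i ∉ interior (convexHull ℝ (Q : Set Pt)))) ∧
    (∀ Q ∈ 𝒬, ∀ Q' ∈ 𝒬, Q ≠ Q' →
      interior (convexHull ℝ (Q : Set Pt)) ∩ interior (convexHull ℝ (Q' : Set Pt)) = ∅) ∧
    (∀ e ∈ F, ∃ Q ∈ 𝒬, IsDiagonalOf Q e)

/-- `P` is a convex polygon: its vertices are in convex position. -/
def SimplePolygon.IsConvex (P : SimplePolygon) : Prop :=
  InConvexPosition (Finset.image P.vtx Finset.univ)

/-- Twice the signed area of the triangle `a b c`. -/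
def orient (a b c : Pt) : ℝ := (b.1 - a.1) * (c.2 - a.2) - (b.2 - a.2) * (c.1 - a.1)

theorem orient_combo (a b p q : Pt) (s t : ℝ) (h : s + t = 1) :
    orient a b (s • p + t • q) = s * orient a b p + t * orient a b q := by
  obtain rfl : t = 1 - s := by linarith
  simp only [orient, Prod.fst_add, Prod.snd_add, Prod.smul_fst, Prod.smul_snd, smul_eq_mul]
  ring

theorem orient_self_left (a b : Pt) : orient a b a = 0 := by simp only [orient]; ring
theorem orient_self_right (a b : Pt) : orient a b b = 0 := by simp only [orient]; ring

theorem orient_eq_zero_of_collinear (a b c : Pt) (h : Collinear ℝ ({a, b, c} : Set Pt)) :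
    orient a b c = 0 := by
  rw [collinear_iff_of_mem (p₀ := a) (by simp)] at h
  obtain ⟨v, hv⟩ := h
  obtain ⟨r, hr⟩ := hv b (by simp)
  obtain ⟨s, hs⟩ := hv c (by simp)
  subst hr hs
  simp [orient]
  ring

/-- Segments with a common endpoint that are not collinear. -/
theorem seg_shared {a b c x : Pt} (h : orient a b c ≠ 0) (h1 : x ∈ segment ℝ a b)
    (h2 : x ∈ segment ℝ a c) : x = a := by
  obtain ⟨s, t, hs, ht, hst, rfl⟩ := h1
  obtain ⟨s', t', hs', ht', hst', he⟩ := h2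
  have e1 := orient_combo a b a b s t hst
  have e2 := orient_combo a b a c s' t' hst'
  rw [he, e1] at e2
  simp only [orient_self_left, orient_self_right] at e2
  have : t' = 0 := by
    rcases mul_eq_zero.1 (show t' * orient a b c = 0 by linarith) with h0 | h0
    · exact h0
    · exact absurd h0 h
  subst this
  have : s' = 1 := by linarith
  subst this
  rw [← he]; simp

theorem seg_sep {a b c d x : Pt} (h : 0 < orient a b c * orient a b d)
    (h1 : x ∈ segment ℝ a b) (h2 : x ∈ segment ℝ c d) : False := by
  obtain ⟨s, t, hs, ht, hst, rfl⟩ := h1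
  obtain ⟨s', t', hs', ht', hst', he⟩ := h2
  have e1 := orient_combo a b a b s t hst
  have e2 := orient_combo a b c d s' t' hst'
  rw [he, e1] at e2
  simp only [orient_self_left, orient_self_right] at e2
  rcases pos_and_pos_or_neg_and_neg_of_mul_pos h with ⟨p, q⟩ | ⟨p, q⟩
  · rcases hs'.eq_or_lt with h0 | h0
    · have : t' = 1 := by linarith
      subst this; nlinarith
    · nlinarith [mul_pos h0 p, mul_nonneg ht' q.le]
  · rcases hs'.eq_or_lt with h0 | h0
    · have : t' = 1 := by linarith
      subst this; nlinarith
    · nlinarith [mul_pos h0 (neg_pos.2 p), mul_nonneg ht' (neg_pos.2 q).le]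

theorem seg_cross {a b c d : Pt} (h1 : orient a b c * orient a b d < 0)
    (h2 : orient c d a * orient c d b < 0) :
    (openSegment ℝ a b ∩ openSegment ℝ c d).Nonempty := by
  have key : ∀ u v : ℝ, u * v < 0 → u - v ≠ 0 ∧ 0 < u / (u - v) ∧ 0 < -v / (u - v) := by
    intro u v huv
    have hne : u - v ≠ 0 := by
      intro h0
      have : u = v := by linarith
      subst this; nlinarith [mul_self_nonneg u]
    refine ⟨hne, ?_, ?_⟩
    · have : u / (u - v) = (u * (u - v)) / ((u - v) * (u - v)) := by field_simp
      rw [this]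
      apply div_pos
      · nlinarith [mul_self_nonneg u]
      · exact mul_self_pos.2 hne
    · have : -v / (u - v) = (-v * (u - v)) / ((u - v) * (u - v)) := by field_simp
      rw [this]
      apply div_pos
      · nlinarith [mul_self_nonneg v]
      · exact mul_self_pos.2 hne
  obtain ⟨n1, p1, q1⟩ := key _ _ h1
  obtain ⟨n2, p2, q2⟩ := key _ _ h2
  refine ⟨(-orient c d b / (orient c d a - orient c d b)) • a +
    (orient c d a / (orient c d a - orient c d b)) • b,
    ⟨_, _, q2, p2, by field_simp; ring, rfl⟩,
    ⟨_, _, q1, p1, by field_simp; ring, ?_⟩⟩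
  ext
  · simp only [Prod.fst_add, Prod.smul_fst, smul_eq_mul]
    field_simp
    simp only [orient]; ring
  · simp only [Prod.snd_add, Prod.smul_snd, smul_eq_mul]
    field_simp
    simp only [orient]; ring

theorem convex_orient_ge (a b : Pt) : Convex ℝ {x | 0 ≤ orient a b x} := by
  intro x hx y hy s t hs ht hst
  simp only [Set.mem_ofPred_eq] at *
  rw [orient_combo _ _ _ _ _ _ hst]
  positivity

theorem hull_orient {A : Set Pt} {a b x : Pt} (h : ∀ q ∈ A, 0 ≤ orient a b q)
    (hx : x ∈ convexHull ℝ A) : 0 ≤ orient a b x :=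
  convexHull_min (t := {x | 0 ≤ orient a b x}) h (convex_orient_ge a b) hx

theorem interior_orient {A : Set Pt} {a b x : Pt} (hab : a ≠ b) (h : ∀ q ∈ A, 0 ≤ orient a b q)
    (hx : x ∈ interior (convexHull ℝ A)) : 0 < orient a b x := by
  have hc : Continuous (fun t : ℝ => x + t • ((b.2 - a.2, a.1 - b.1) : Pt)) := by fun_prop
  have hm : ∀ᶠ t in nhds (0 : ℝ),
      x + t • ((b.2 - a.2, a.1 - b.1) : Pt) ∈ convexHull ℝ A := by
    apply hc.continuousAt.eventually
    simpa using mem_interior_iff_mem_nhds.1 hx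
  obtain ⟨ε, hε, hb⟩ := Metric.eventually_nhds_iff.1 hm
  have h2 := hull_orient h (hb (y := ε / 2) (by
    rw [Real.dist_eq, sub_zero, abs_of_pos (by positivity)]; linarith))
  have e : orient a b (x + (ε / 2) • ((b.2 - a.2, a.1 - b.1) : Pt)) =
      orient a b x - ε / 2 * ((b.1 - a.1) ^ 2 + (b.2 - a.2) ^ 2) := by
    simp only [orient, Prod.fst_add, Prod.snd_add, Prod.smul_fst, Prod.smul_snd, smul_eq_mul]
    ring
  have hpos : 0 < (b.1 - a.1) ^ 2 + (b.2 - a.2) ^ 2 := by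
    by_contra hn
    apply hab
    have h1 : b.1 - a.1 = 0 := by nlinarith [sq_nonneg (b.1 - a.1), sq_nonneg (b.2 - a.2)]
    have h2 : b.2 - a.2 = 0 := by nlinarith [sq_nonneg (b.1 - a.1), sq_nonneg (b.2 - a.2)]
    ext <;> linarith
  rw [e] at h2
  nlinarith [mul_pos (half_pos hε) hpos]

theorem mem_triangle {a b c z : Pt} (h0 : 0 < orient a b c) (h1 : 0 ≤ orient a b z)
    (h2 : 0 ≤ orient b c z) (h3 : 0 ≤ orient c a z) : z ∈ convexHull ℝ ({a, b, c} : Set Pt) := by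
  have hc := convex_convexHull ℝ ({a, b, c} : Set Pt)
  have hs := hc.sum_mem (t := Finset.univ)
    (w := ![orient b c z / orient a b c, orient c a z / orient a b c, orient a b z / orient a b c])
    (z := ![a, b, c]) ?_ ?_ ?_
  · convert hs using 1
    simp only [Fin.sum_univ_three, Matrix.cons_val]
    ext
    · simp only [Prod.fst_add, Prod.smul_fst, smul_eq_mul]
      field_simp
      simp only [orient]; ring
    · simp only [Prod.snd_add, Prod.smul_snd, smul_eq_mul]
      field_simp
      simp only [orient]; ring
  · intro i _
    fin_cases i <;> simp <;> positivity
  · simp only [Fin.sum_univ_three, Matrix.cons_val]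
    field_simp
    simp only [orient]; ring
  · intro i _
    apply subset_convexHull
    fin_cases i <;> simp

theorem continuous_orient (a b : Pt) : Continuous (orient a b) := by
  unfold orient; fun_prop

/-- A diagonal of a convex quadrilateral runs in its interior. -/
theorem quad_diag {A : Set Pt} {a b c d : Pt} (hA : {a, b, c, d} ⊆ A) (h1 : 0 < orient a b c)
    (h2 : 0 < orient a c d) (h3 : 0 < orient a b d) (h4 : 0 < orient b c d) :
    openSegment ℝ a c ⊆ interior (convexHull ℝ A) := by
  set U : Set Pt := {z | 0 < orient a b z ∧ 0 < orient b c z ∧ 0 < orient c d z ∧ 0 < orient d a z}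
  have hU : IsOpen U :=
    (isOpen_lt continuous_const (continuous_orient a b)).inter
    ((isOpen_lt continuous_const (continuous_orient b c)).inter
    ((isOpen_lt continuous_const (continuous_orient c d)).inter
    (isOpen_lt continuous_const (continuous_orient d a))))
  have hsub : U ⊆ convexHull ℝ A := by
    rintro z ⟨k1, k2, k3, k4⟩
    rcases le_total 0 (orient a c z) with h | h
    · refine convexHull_mono ?_ (mem_triangle h2 h k3.le k4.le)
      refine subset_trans ?_ hA
      intro x; simp; tauto
    · refine convexHull_mono ?_ (mem_triangle h1 k1.le k2.le ?_)
      · refine subset_trans ?_ hA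
        intro x; simp; tauto
      · have : orient c a z = - orient a c z := by simp only [orient]; ring
        linarith
  refine subset_trans ?_ (interior_maximal hsub hU)
  rintro _ ⟨s, t, hs, ht, hst, rfl⟩
  have e1 : orient b c a = orient a b c := by simp only [orient]; ring
  have e2 : orient c d a = orient a c d := by simp only [orient]; ring
  have e3 : orient d a c = orient a c d := by simp only [orient]; ring
  refine ⟨?_, ?_, ?_, ?_⟩ <;> rw [orient_combo _ _ _ _ _ _ hst] <;>
    simp only [orient_self_left, orient_self_right, e1, e2, e3] <;> simp <;> positivity

/-! ### The hexagon -/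

/-- Integer coordinates of the vertices. -/
def vX : Fin 6 → ℤ := ![0, -2, 1, 2, 1, -2]
def vY : Fin 6 → ℤ := ![0, -1, -2, 0, 2, 1]
def v (i : Fin 6) : Pt := ((vX i : ℝ), (vY i : ℝ))

def orZ (i j k : Fin 6) : ℤ := (vX j - vX i) * (vY k - vY i) - (vY j - vY i) * (vX k - vX i)

theorem orient_v (i j k : Fin 6) : orient (v i) (v j) (v k) = (orZ i j k : ℝ) := by
  simp [orient, v, orZ]

theorem orZ_ne : ∀ i j k : Fin 6, i ≠ j → i ≠ k → j ≠ k → orZ i j k ≠ 0 := by decide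

theorem vXY_inj : ∀ i j : Fin 6, vX i = vX j → vY i = vY j → i = j := by decide

theorem v_inj : Function.Injective v := by
  intro i j h
  simp only [v, Prod.mk.injEq, Int.cast_inj] at h
  exact vXY_inj i j h.1 h.2

def ZCross (i j k l : Fin 6) : Prop := orZ i j k * orZ i j l < 0 ∧ orZ k l i * orZ k l j < 0

instance (i j k l : Fin 6) : Decidable (ZCross i j k l) := by unfold ZCross; infer_instance

theorem cross_v {i j k l : Fin 6} (h : ZCross i j k l) :
    (openSegment ℝ (v i) (v j) ∩ openSegment ℝ (v k) (v l)).Nonempty := by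
  apply seg_cross <;> simp only [orient_v]
  · exact_mod_cast h.1
  · exact_mod_cast h.2

theorem noncross_v {i j k l : Fin 6} (hij : i ≠ j) (hkl : k ≠ l)
    (hne : s(v i, v j) ≠ s(v k, v l)) (h : ¬ ZCross i j k l) (x : Pt)
    (h1 : x ∈ segment ℝ (v i) (v j)) (h2 : x ∈ segment ℝ (v k) (v l)) :
    x ∈ s(v i, v j) ∧ x ∈ s(v k, v l) := by
  have sh : ∀ a b c : Fin 6, a ≠ b → a ≠ c → b ≠ c → x ∈ segment ℝ (v a) (v b) →
      x ∈ segment ℝ (v a) (v c) → x = v a := by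
    intro a b c hab hac hbc
    apply seg_shared
    rw [orient_v]
    exact_mod_cast orZ_ne a b c hab hac hbc
  by_cases e1 : i = k
  · subst e1
    have : j ≠ l := by rintro rfl; exact hne rfl
    simp [sh i j l hij hkl this h1 h2]
  by_cases e2 : i = l
  · subst e2
    rw [segment_symm] at h2
    have : j ≠ k := by rintro rfl; exact hne Sym2.eq_swap
    simp [sh i j k hij e1 this h1 h2]
  by_cases e3 : j = k
  · subst e3
    rw [segment_symm] at h1
    simp [sh j i l hij.symm hkl e2 h1 h2]
  by_cases e4 : j = l
  · subst e4
    rw [segment_symm] at h1 h2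
    simp [sh j i k hij.symm e3 e1 h1 h2]
  exfalso
  have a1 : orZ i j k * orZ i j l ≠ 0 := mul_ne_zero (orZ_ne _ _ _ hij e1 e3) (orZ_ne _ _ _ hij e2 e4)
  have a2 : orZ k l i * orZ k l j ≠ 0 :=
    mul_ne_zero (orZ_ne _ _ _ hkl (Ne.symm e1) (Ne.symm e2)) (orZ_ne _ _ _ hkl (Ne.symm e3) (Ne.symm e4))
  by_cases c1 : orZ i j k * orZ i j l < 0
  · have c2 : ¬ orZ k l i * orZ k l j < 0 := fun c2 => h ⟨c1, c2⟩
    have : 0 < orZ k l i * orZ k l j := by omega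
    refine seg_sep ?_ h2 h1
    simp only [orient_v]; exact_mod_cast this
  · have : 0 < orZ i j k * orZ i j l := by omega
    refine seg_sep ?_ h1 h2
    simp only [orient_v]; exact_mod_cast this

theorem edges_noncross : ∀ i j : Fin 6, ¬ ZCross i (i + 1) j (j + 1) := by decide

theorem ne_succ6 : ∀ i : Fin 6, i ≠ i + 1 := by decide

def hex : SimplePolygon where
  n := 6
  three_le := by norm_num
  vtx := v
  inj := v_inj
  genpos := by
    intro i j k hij hik hjk hc
    have := orient_eq_zero_of_collinear _ _ _ hc
    rw [orient_v] at this
    exact orZ_ne i j k hij hik hjk (by exact_mod_cast this)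
  noncrossing := by
    intro i j hne x hx
    simp only [finRotate_apply] at hne hx ⊢
    exact noncross_v (ne_succ6 i) (ne_succ6 j) hne (edges_noncross i j) x hx.1 hx.2

theorem hex_vtx (i : Fin 6) : hex.vtx i = v i := rfl

theorem rot (i : Fin 6) : hex.vtx (finRotate hex.n i) = v (i + 1) :=
  congrArg v (finRotate_apply (n := 6) i)

theorem mem_boundary {x : Pt} :
    x ∈ hex.boundary ↔ ∃ i : Fin 6, x ∈ segment ℝ (v i) (v (i + 1)) := by
  unfold SimplePolygon.boundary
  rw [Set.mem_iUnion]
  apply exists_congr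
  intro i
  exact Iff.of_eq (congrArg (fun p => x ∈ segment ℝ (v i) p) (rot i))

theorem v0 : v 0 = (0, 0) := by
  change (((0 : ℤ) : ℝ), ((0 : ℤ) : ℝ)) = _; norm_num
theorem v1 : v 1 = (-2, -1) := by
  change (((-2 : ℤ) : ℝ), ((-1 : ℤ) : ℝ)) = _; norm_num
theorem v2 : v 2 = (1, -2) := by
  change (((1 : ℤ) : ℝ), ((-2 : ℤ) : ℝ)) = _; norm_num
theorem v3 : v 3 = (2, 0) := by
  change (((2 : ℤ) : ℝ), ((0 : ℤ) : ℝ)) = _; norm_num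
theorem v4 : v 4 = (1, 2) := by
  change (((1 : ℤ) : ℝ), ((2 : ℤ) : ℝ)) = _; norm_num
theorem v5 : v 5 = (-2, 1) := by
  change (((-2 : ℤ) : ℝ), ((1 : ℤ) : ℝ)) = _; norm_num

theorem mem_seg {x y a b c d : ℝ} : ((x, y) : Pt) ∈ segment ℝ ((a, b) : Pt) (c, d) ↔
    ∃ t : ℝ, 0 ≤ t ∧ t ≤ 1 ∧ x = (1 - t) * a + t * c ∧ y = (1 - t) * b + t * d := by
  constructor
  · rintro ⟨s, t, hs, ht, hst, he⟩
    obtain rfl : s = 1 - t := by linarith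
    have e1 := congrArg Prod.fst he
    have e2 := congrArg Prod.snd he
    simp at e1 e2
    exact ⟨t, ht, by linarith, e1.symm, e2.symm⟩
  · rintro ⟨t, h0, h1, rfl, rfl⟩
    exact ⟨1 - t, t, by linarith, h0, by ring, by ext <;> simp⟩

theorem mem_bd {x y : ℝ} : ((x, y) : Pt) ∈ hex.boundary ↔
    ((x, y) : Pt) ∈ segment ℝ ((0, 0) : Pt) (-2, -1) ∨
    ((x, y) : Pt) ∈ segment ℝ ((-2, -1) : Pt) (1, -2) ∨
    ((x, y) : Pt) ∈ segment ℝ ((1, -2) : Pt) (2, 0) ∨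
    ((x, y) : Pt) ∈ segment ℝ ((2, 0) : Pt) (1, 2) ∨
    ((x, y) : Pt) ∈ segment ℝ ((1, 2) : Pt) (-2, 1) ∨
    ((x, y) : Pt) ∈ segment ℝ ((-2, 1) : Pt) (0, 0) := by
  rw [mem_boundary, ← v0, ← v1, ← v2, ← v3, ← v4, ← v5]
  constructor
  · rintro ⟨i, hi⟩
    match i, hi with
    | 0, hi => exact Or.inl hi
    | 1, hi => exact Or.inr (Or.inl hi)
    | 2, hi => exact Or.inr (Or.inr (Or.inl hi))
    | 3, hi => exact Or.inr (Or.inr (Or.inr (Or.inl hi)))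
    | 4, hi => exact Or.inr (Or.inr (Or.inr (Or.inr (Or.inl hi))))
    | 5, hi => exact Or.inr (Or.inr (Or.inr (Or.inr (Or.inr hi))))
  · rintro (h | h | h | h | h | h)
    · exact ⟨0, h⟩
    · exact ⟨1, h⟩
    · exact ⟨2, h⟩
    · exact ⟨3, h⟩
    · exact ⟨4, h⟩
    · exact ⟨5, h⟩

/-- The open interior region of the hexagon. -/
def regU : Set Pt := {z | 2 * z.1 + |z.2| < 4 ∧ 3 * |z.2| < z.1 + 5 ∧ 0 < z.1 + 2 * |z.2|}
def regV : Set Pt := {z | 4 < 2 * z.1 + |z.2| ∨ z.1 + 5 < 3 * |z.2| ∨ z.1 + 2 * |z.2| < 0}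

theorem regU_open : IsOpen regU :=
  (isOpen_lt (f := fun z : Pt => 2 * z.1 + |z.2|) (by fun_prop) continuous_const).inter
  ((isOpen_lt (f := fun z : Pt => 3 * |z.2|) (g := fun z : Pt => z.1 + 5)
    (by fun_prop) (by fun_prop)).inter
  (isOpen_lt (g := fun z : Pt => z.1 + 2 * |z.2|) continuous_const (by fun_prop)))

theorem regV_open : IsOpen regV :=
  (isOpen_lt (g := fun z : Pt => 2 * z.1 + |z.2|) continuous_const (by fun_prop)).union
  ((isOpen_lt (g := fun z : Pt => 3 * |z.2|) (f := fun z : Pt => z.1 + 5)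
    (by fun_prop) (by fun_prop)).union
  (isOpen_lt (f := fun z : Pt => z.1 + 2 * |z.2|) (by fun_prop) continuous_const))

theorem compl_boundary : hex.boundaryᶜ ⊆ regU ∪ regV := by
  rintro ⟨x, y⟩ hb
  by_contra hn
  apply hb
  simp only [regU, regV, Set.mem_union, Set.mem_ofPred_eq, not_or, not_and_or, not_lt] at hn
  obtain ⟨h, g1, g2, g3⟩ := hn
  rw [mem_bd]
  simp only [mem_seg]
  rcases abs_cases y with ⟨ha, hy⟩ | ⟨ha, hy⟩ <;> rw [ha] at h g1 g2 g3
  · rcases h with h | h | h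
    · refine Or.inr (Or.inr (Or.inr (Or.inl ⟨y / 2, ?_, ?_, ?_, ?_⟩))) <;> linarith
    · refine Or.inr (Or.inr (Or.inr (Or.inr (Or.inl ⟨2 - y, ?_, ?_, ?_, ?_⟩)))) <;> linarith
    · refine Or.inr (Or.inr (Or.inr (Or.inr (Or.inr ⟨1 - y, ?_, ?_, ?_, ?_⟩)))) <;> linarith
  · rcases h with h | h | h
    · refine Or.inr (Or.inr (Or.inl ⟨y / 2 + 1, ?_, ?_, ?_, ?_⟩)) <;> linarith
    · refine Or.inr (Or.inl ⟨-1 - y, ?_, ?_, ?_, ?_⟩) <;> linarith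
    · refine Or.inl ⟨-y, ?_, ?_, ?_, ?_⟩ <;> linarith

theorem boundary_not_regU {z : Pt} (hz : z ∈ hex.boundary) : z ∉ regU := by
  obtain ⟨x, y⟩ := z
  rw [mem_bd] at hz
  simp only [mem_seg] at hz
  rintro ⟨h1, h2, h3⟩
  simp only at h1 h2 h3
  rcases abs_cases y with ⟨ha, hy⟩ | ⟨ha, hy⟩ <;> rw [ha] at h1 h2 h3 <;>
    rcases hz with ⟨t, h4, h5, h6, h7⟩ | ⟨t, h4, h5, h6, h7⟩ | ⟨t, h4, h5, h6, h7⟩ |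
      ⟨t, h4, h5, h6, h7⟩ | ⟨t, h4, h5, h6, h7⟩ | ⟨t, h4, h5, h6, h7⟩ <;> linarith

theorem disj_UV : Disjoint regU regV := by
  rw [Set.disjoint_left]
  rintro z ⟨h1, h2, h3⟩ (h | h | h) <;> linarith

theorem regU_bounded : Bornology.IsBounded regU := by
  refine (Metric.isBounded_closedBall (x := (0 : Pt)) (r := 10)).subset ?_
  rintro ⟨x, y⟩ ⟨h1, h2, h3⟩
  simp only at h1 h2 h3
  rw [mem_closedBall_zero_iff, Prod.norm_def, max_le_iff, Real.norm_eq_abs, Real.norm_eq_abs]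
  have := abs_nonneg y
  exact ⟨abs_le.2 ⟨by linarith, by linarith⟩, by linarith⟩

theorem regU_inside : regU ⊆ hex.inside := by
  intro z hz
  have hzb : z ∉ hex.boundary := fun h => boundary_not_regU h hz
  refine ⟨hzb, regU_bounded.subset ?_⟩
  apply IsPreconnected.subset_left_of_subset_union regU_open regV_open disj_UV
  · exact (connectedComponentIn_subset _ _).trans compl_boundary
  · exact ⟨z, mem_connectedComponentIn hzb, hz⟩
  · exact isPreconnected_connectedComponentIn

theorem boundary_left {x : ℝ} (hx : x < 0) : ((x, 0) : Pt) ∉ hex.boundary := by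
  intro h
  rw [mem_bd] at h
  simp only [mem_seg] at h
  rcases h with ⟨t, h4, h5, h6, h7⟩ | ⟨t, h4, h5, h6, h7⟩ | ⟨t, h4, h5, h6, h7⟩ |
      ⟨t, h4, h5, h6, h7⟩ | ⟨t, h4, h5, h6, h7⟩ | ⟨t, h4, h5, h6, h7⟩ <;> linarith

theorem left_not_inside : ((-2, 0) : Pt) ∉ hex.inside := by
  rintro ⟨_, hb⟩
  have hpre : IsPreconnected ((fun x : ℝ => ((x, 0) : Pt)) '' Set.Iio 0) :=
    isPreconnected_Iio.image _ (by fun_prop)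
  have hsub := hpre.subset_connectedComponentIn (F := hex.boundaryᶜ) (x := ((-2, 0) : Pt))
    ⟨-2, by norm_num, rfl⟩ (by rintro _ ⟨x, hx, rfl⟩; exact boundary_left hx)
  obtain ⟨R, hR⟩ := (hb.subset hsub).exists_norm_le
  have := hR (-(|R| + 1), 0) ⟨-(|R| + 1), by
    have := abs_nonneg R
    simp only [Set.mem_Iio]; linarith, rfl⟩
  rw [Prod.norm_def] at this
  have h2 := (le_max_left _ _).trans this
  simp only [norm_neg, Real.norm_eq_abs] at h2
  rw [abs_of_nonneg (by positivity)] at h2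
  linarith [le_abs_self R]

/-! ### Diagonals -/

def dA : Fin 6 → Fin 6 := ![0, 0, 0, 1, 2, 3]
def dB : Fin 6 → Fin 6 := ![2, 3, 4, 3, 4, 5]
def dg (k : Fin 6) : Sym2 Pt := s(v (dA k), v (dB k))

theorem sym_v {i j k l : Fin 6} : s(v i, v j) = s(v k, v l) ↔ s(i, j) = s(k, l) := by
  simp only [Sym2.eq_iff, v_inj.eq_iff]

theorem dAB_inj : ∀ k l : Fin 6, s(dA k, dB k) = s(dA l, dB l) → k = l := by decide

theorem dg_inj : Function.Injective dg := fun k l h => dAB_inj k l (sym_v.1 h)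

theorem open_regU {a b c d : ℝ}
    (h : ∀ x y t : ℝ, 0 < t → t < 1 → x = (1 - t) * a + t * c → y = (1 - t) * b + t * d →
      2 * x + |y| < 4 ∧ 3 * |y| < x + 5 ∧ 0 < x + 2 * |y|) :
    openSegment ℝ ((a, b) : Pt) (c, d) ⊆ hex.inside := by
  refine subset_trans ?_ regU_inside
  rintro _ ⟨s, t, hs, ht, hst, rfl⟩
  obtain rfl : s = 1 - t := by linarith
  exact h _ _ t ht (by linarith) rfl rfl

theorem dg_inside (k : Fin 6) : openSegment ℝ (v (dA k)) (v (dB k)) ⊆ hex.inside := by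
  match k with
  | 0 =>
    change openSegment ℝ (v 0) (v 2) ⊆ _
    rw [v0, v2]; apply open_regU; intro x y t h0 h1 hx hy
    rcases abs_cases y with ⟨ha, hb⟩ | ⟨ha, hb⟩ <;> rw [ha] <;>
      refine ⟨?_, ?_, ?_⟩ <;> linarith
  | 1 =>
    change openSegment ℝ (v 0) (v 3) ⊆ _
    rw [v0, v3]; apply open_regU; intro x y t h0 h1 hx hy
    rcases abs_cases y with ⟨ha, hb⟩ | ⟨ha, hb⟩ <;> rw [ha] <;>
      refine ⟨?_, ?_, ?_⟩ <;> linarith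
  | 2 =>
    change openSegment ℝ (v 0) (v 4) ⊆ _
    rw [v0, v4]; apply open_regU; intro x y t h0 h1 hx hy
    rcases abs_cases y with ⟨ha, hb⟩ | ⟨ha, hb⟩ <;> rw [ha] <;>
      refine ⟨?_, ?_, ?_⟩ <;> linarith
  | 3 =>
    change openSegment ℝ (v 1) (v 3) ⊆ _
    rw [v1, v3]; apply open_regU; intro x y t h0 h1 hx hy
    rcases abs_cases y with ⟨ha, hb⟩ | ⟨ha, hb⟩ <;> rw [ha] <;>
      refine ⟨?_, ?_, ?_⟩ <;> linarith
  | 4 =>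
    change openSegment ℝ (v 2) (v 4) ⊆ _
    rw [v2, v4]; apply open_regU; intro x y t h0 h1 hx hy
    rcases abs_cases y with ⟨ha, hb⟩ | ⟨ha, hb⟩ <;> rw [ha] <;>
      refine ⟨?_, ?_, ?_⟩ <;> linarith
  | 5 =>
    change openSegment ℝ (v 3) (v 5) ⊆ _
    rw [v3, v5]; apply open_regU; intro x y t h0 h1 hx hy
    rcases abs_cases y with ⟨ha, hb⟩ | ⟨ha, hb⟩ <;> rw [ha] <;>
      refine ⟨?_, ?_, ?_⟩ <;> linarith

theorem classify : ∀ i j : Fin 6, i = j ∨ j = i + 1 ∨ i = j + 1 ∨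
    (∃ k, ZCross i j k (k + 1)) ∨ s(i, j) = s(1, 5) ∨ ∃ k, s(i, j) = s(dA k, dB k) := by decide

theorem openSegment_nonempty' (a b : Pt) : (openSegment ℝ a b).Nonempty :=
  ⟨_, 1 / 2, 1 / 2, by norm_num, by norm_num, by norm_num, rfl⟩

theorem isDiagonal_iff {e : Sym2 Pt} : hex.IsDiagonal e ↔ ∃ k, e = dg k := by
  constructor
  · rintro ⟨i, j, rfl, h⟩
    change Fin 6 at i j
    change openSegment ℝ (v i) (v j) ⊆ _ at h
    have nb : ∀ x ∈ openSegment ℝ (v i) (v j), x ∉ hex.boundary := fun x hx => (h hx).1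
    rcases classify i j with c | c | c | ⟨k, c⟩ | c | ⟨k, c⟩
    · subst c
      refine absurd (mem_boundary.2 ⟨i, left_mem_segment ℝ _ _⟩) (nb (v i) ?_)
      rw [openSegment_same]; rfl
    · subst c
      obtain ⟨x, hx⟩ := openSegment_nonempty' (v i) (v (i + 1))
      exact absurd (mem_boundary.2 ⟨i, openSegment_subset_segment _ _ _ hx⟩) (nb x hx)
    · subst c
      rw [openSegment_symm] at nb
      obtain ⟨x, hx⟩ := openSegment_nonempty' (v j) (v (j + 1))
      exact absurd (mem_boundary.2 ⟨j, openSegment_subset_segment _ _ _ hx⟩) (nb x hx)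
    · obtain ⟨x, hx, hx'⟩ := cross_v c
      exact absurd (mem_boundary.2 ⟨k, openSegment_subset_segment _ _ _ hx'⟩) (nb x hx)
    · exfalso
      apply left_not_inside
      apply h
      have : ((-2, 0) : Pt) ∈ openSegment ℝ (v 1) (v 5) := by
        refine ⟨1 / 2, 1 / 2, by norm_num, by norm_num, by norm_num, ?_⟩
        rw [v1, v5]; ext <;> norm_num
      rcases Sym2.eq_iff.1 c with ⟨rfl, rfl⟩ | ⟨rfl, rfl⟩
      · exact this
      · rw [openSegment_symm]; exact this
    · exact ⟨k, sym_v.2 c⟩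
  · rintro ⟨k, rfl⟩
    exact ⟨dA k, dB k, rfl, dg_inside k⟩

def Conf (k l : Fin 6) : Prop := ZCross (dA k) (dB k) (dA l) (dB l)

instance (k l : Fin 6) : Decidable (Conf k l) := by unfold Conf; infer_instance

theorem dAB_ne : ∀ k, dA k ≠ dB k := by decide

theorem seg2_dg (k : Fin 6) : seg2 (dg k) = segment ℝ (v (dA k)) (v (dB k)) := rfl

theorem conf_iff {k l : Fin 6} (hkl : k ≠ l) :
    (∀ x ∈ seg2 (dg k) ∩ seg2 (dg l), x ∈ dg k ∧ x ∈ dg l) ↔ ¬ Conf k l := by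
  constructor
  · intro h hc
    obtain ⟨x, hx, hx'⟩ := cross_v hc
    have hm := (h x ⟨openSegment_subset_segment _ _ _ hx, openSegment_subset_segment _ _ _ hx'⟩).1
    have hne : v (dA k) ≠ v (dB k) := fun h => dAB_ne k (v_inj h)
    rcases Sym2.mem_iff.1 hm with rfl | rfl
    · exact hne (left_mem_openSegment_iff.1 hx)
    · exact hne (right_mem_openSegment_iff.1 hx)
  · intro hc x hx
    exact noncross_v (dAB_ne k) (dAB_ne l) (fun h => hkl (dg_inj h)) hc x hx.1 hx.2

def Good (S : Finset (Fin 6)) : Prop :=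
  (∀ k ∈ S, ∀ l ∈ S, k ≠ l → ¬ Conf k l) ∧ ∀ k, (∀ l ∈ S, k ≠ l → ¬ Conf k l) → k ∈ S

instance : DecidablePred Good := fun S => by unfold Good; infer_instance

def dgE : Fin 6 ↪ Sym2 Pt := ⟨dg, dg_inj⟩

def mkTri (S : Finset (Fin 6)) (h : Good S) : PolyTriangulation hex where
  diags := S.map dgE
  isDiag := by
    intro e he
    obtain ⟨k, _, rfl⟩ := Finset.mem_map.1 he
    exact isDiagonal_iff.2 ⟨k, rfl⟩
  noncrossing := by
    intro e₁ h₁ e₂ h₂ hne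
    obtain ⟨k, hk, rfl⟩ := Finset.mem_map.1 h₁
    obtain ⟨l, hl, rfl⟩ := Finset.mem_map.1 h₂
    have hkl : k ≠ l := by rintro rfl; exact hne rfl
    exact (conf_iff hkl).2 (h.1 k hk l hl hkl)
  maximal := by
    intro e he hall
    obtain ⟨k, rfl⟩ := isDiagonal_iff.1 he
    refine Finset.mem_map.2 ⟨k, h.2 k ?_, rfl⟩
    intro l hl hkl
    exact (conf_iff hkl).1 (hall (dg l) (Finset.mem_map.2 ⟨l, hl, rfl⟩) (fun h => hkl (dg_inj h)))

theorem PolyTriangulation.ext' {P : SimplePolygon} {D E : PolyTriangulation P}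
    (h : D.diags = E.diags) : D = E := by
  cases D; cases E; cases h; rfl

theorem mkTri_surj (D : PolyTriangulation hex) : ∃ S, ∃ h : Good S, mkTri S h = D := by
  have hmem : ∀ k, k ∈ Finset.univ.filter (fun k => dg k ∈ D.diags) ↔ dg k ∈ D.diags := by
    intro k; simp
  refine ⟨Finset.univ.filter (fun k => dg k ∈ D.diags), ⟨?_, ?_⟩, ?_⟩
  · intro k hk l hl hkl
    rw [hmem] at hk hl
    exact (conf_iff hkl).1 (D.noncrossing _ hk _ hl (fun h => hkl (dg_inj h)))
  · intro k hk
    rw [hmem]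
    apply D.maximal _ (isDiagonal_iff.2 ⟨k, rfl⟩)
    intro e' he' hne
    obtain ⟨l, rfl⟩ := isDiagonal_iff.1 (D.isDiag e' he')
    have hkl : k ≠ l := by rintro rfl; exact hne rfl
    exact (conf_iff hkl).2 (hk l ((hmem l).2 he') hkl)
  · apply PolyTriangulation.ext'
    ext e
    change e ∈ Finset.map _ _ ↔ _
    rw [Finset.mem_map]
    constructor
    · rintro ⟨k, hk, rfl⟩
      exact (hmem k).1 hk
    · intro he
      obtain ⟨k, rfl⟩ := isDiagonal_iff.1 (D.isDiag e he)
      exact ⟨k, (hmem k).2 he, rfl⟩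

set_option maxRecDepth 100000 in
theorem good_card : Fintype.card {S : Finset (Fin 6) // Good S} = 5 := by decide +kernel

theorem hex_count : polyTriCount hex = 5 := by
  rw [polyTriCount, ← good_card, ← Nat.card_eq_fintype_card]
  symm
  apply Nat.card_congr
  refine Equiv.ofBijective (fun S => mkTri S.1 S.2) ⟨?_, ?_⟩
  · intro S T h
    apply Subtype.ext
    exact Finset.map_injective dgE (congrArg PolyTriangulation.diags h)
  · intro D
    obtain ⟨S, h, rfl⟩ := mkTri_surj D
    exact ⟨⟨S, h⟩, rfl⟩

theorem good0 : Good {0, 1, 2} := by decide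

def D0 : PolyTriangulation hex := mkTri {0, 1, 2} good0

def ZEdge (i j : Fin 6) : Prop :=
  j = i + 1 ∨ i = j + 1 ∨ ∃ k ∈ ({0, 1, 2} : Finset (Fin 6)), s(i, j) = s(dA k, dB k)

instance (i j : Fin 6) : Decidable (ZEdge i j) := by unfold ZEdge; infer_instance

theorem zedge {i j : Fin 6} (h : ZEdge i j) : D0.IsEdgeOrDiag s(v i, v j) := by
  rcases h with rfl | rfl | ⟨k, hk, h⟩
  · exact Or.inl ⟨i, congrArg (fun p => s(v i, p)) (rot i).symm⟩
  · exact Or.inl ⟨j, Sym2.eq_swap.trans (congrArg (fun p => s(v j, p)) (rot j).symm)⟩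
  · exact Or.inr (Finset.mem_map.2 ⟨k, hk, (sym_v.2 h).symm⟩)

/-- No vertex lies in the interior of the hull of the vertices in `S`. -/
def ZEmpty (S : Finset (Fin 6)) : Prop :=
  ∀ i, ∃ a b : Fin 6, a ≠ b ∧ (∀ q ∈ S, 0 ≤ orZ a b q) ∧ orZ a b i ≤ 0

instance (S : Finset (Fin 6)) : Decidable (ZEmpty S) := by unfold ZEmpty; infer_instance

theorem zempty {S : Finset (Fin 6)} (h : ZEmpty S) (i : Fin 6) :
    v i ∉ interior (convexHull ℝ (v '' S)) := by
  intro hi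
  obtain ⟨a, b, hab, hS, hle⟩ := h i
  have := interior_orient (fun h => hab (v_inj h)) (a := v a) (b := v b) (by
    rintro _ ⟨q, hq, rfl⟩
    rw [orient_v]; exact_mod_cast hS q hq) hi
  rw [orient_v] at this
  have h2 : 0 < orZ a b i := by exact_mod_cast this
  omega

theorem zface {i j k : Fin 6} (h1 : ZEdge i j) (h2 : ZEdge j k) (h3 : ZEdge i k)
    (h4 : ZEmpty {i, j, k}) : D0.IsFace (v i) (v j) (v k) := by
  refine ⟨⟨i, rfl⟩, ⟨j, rfl⟩, ⟨k, rfl⟩, zedge h1, zedge h2, zedge h3, fun l => ?_⟩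
  have := zempty h4 l
  change v l ∉ _
  simpa [Set.image_insert_eq] using this

theorem flip_all : ∀ k ∈ ({0, 1, 2} : Finset (Fin 6)), D0.IsFlippable (dg k) := by
  intro k hk
  refine ⟨Finset.mem_map.2 ⟨k, hk, rfl⟩, ?_⟩
  have hc : ∀ k ∈ ({0, 1, 2} : Finset (Fin 6)), ∃ c d : Fin 6, c ≠ d ∧
      ZEdge (dA k) (dB k) ∧ ZEdge (dB k) c ∧ ZEdge (dA k) c ∧ ZEmpty {dA k, dB k, c} ∧
      ZEdge (dB k) d ∧ ZEdge (dA k) d ∧ ZEmpty {dA k, dB k, d} ∧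
      ZCross (dA k) (dB k) c d := by
    decide +kernel
  obtain ⟨c, d, hcd, a1, a2, a3, a4, a5, a6, a7, a8⟩ := hc k hk
  exact ⟨_, _, v c, v d, rfl, fun h => hcd (v_inj h), zface a1 a2 a3 a4, zface a1 a5 a6 a7,
    cross_v a8⟩

theorem D0_flipCount : D0.flipCount = 3 := by
  unfold PolyTriangulation.flipCount
  rw [Finset.filter_true_of_mem]
  · change (Finset.map dgE {0, 1, 2}).card = 3
    rw [Finset.card_map]; rfl
  · intro e he
    obtain ⟨k, hk, rfl⟩ := Finset.mem_map.1 he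
    exact flip_all k hk

def vE : Fin 6 ↪ Pt := ⟨v, v_inj⟩

def ZConvex (S : Finset (Fin 6)) : Prop :=
  ∀ p ∈ S, ∃ a b : Fin 6, orZ a b p < 0 ∧ ∀ q ∈ S, q ≠ p → 0 ≤ orZ a b q

instance (S : Finset (Fin 6)) : Decidable (ZConvex S) := by unfold ZConvex; infer_instance

theorem zconvex {S : Finset (Fin 6)} (h : ZConvex S) : InConvexPosition (S.map vE) := by
  intro p hp hmem
  obtain ⟨i, hi, rfl⟩ := Finset.mem_map.1 hp
  obtain ⟨a, b, hlt, hS⟩ := h i hi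
  have := hull_orient (a := v a) (b := v b) (by
    intro q hq
    rw [Finset.mem_coe, Finset.mem_erase] at hq
    obtain ⟨j, hj, rfl⟩ := Finset.mem_map.1 hq.2
    have hji : j ≠ i := by rintro rfl; exact hq.1 rfl
    change 0 ≤ orient (v a) (v b) (v j)
    rw [orient_v]; exact_mod_cast hS j hj hji) hmem
  change 0 ≤ orient (v a) (v b) (v i) at this
  rw [orient_v] at this
  have h2 : 0 ≤ orZ a b i := by exact_mod_cast this
  omega

/-- `i j` is a diagonal of a convex quadrilateral with vertices in `S`. -/
def ZDiag (S : Finset (Fin 6)) (i j : Fin 6) : Prop :=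
  ∃ b ∈ S, ∃ d ∈ S, 0 < orZ i b j ∧ 0 < orZ i j d ∧ 0 < orZ i b d ∧ 0 < orZ b j d

instance (S : Finset (Fin 6)) (i j : Fin 6) : Decidable (ZDiag S i j) := by
  unfold ZDiag; infer_instance

theorem zdiag {S : Finset (Fin 6)} {i j : Fin 6} (hi : i ∈ S) (hj : j ∈ S) (h : ZDiag S i j) :
    openSegment ℝ (v i) (v j) ⊆ interior (convexHull ℝ (↑(S.map vE) : Set Pt)) := by
  obtain ⟨b, hb, d, hd, h1, h2, h3, h4⟩ := h
  refine quad_diag (b := v b) (d := v d) ?_ ?_ ?_ ?_ ?_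
  · intro x hx
    have hm : ∀ k ∈ S, v k ∈ (↑(S.map vE) : Set Pt) := fun k hk =>
      Finset.mem_coe.2 (Finset.mem_map.2 ⟨k, hk, rfl⟩)
    rcases hx with rfl | rfl | rfl | rfl
    · exact hm _ hi
    · exact hm _ hb
    · exact hm _ hj
    · exact hm _ hd
  all_goals rw [orient_v]
  all_goals assumption_mod_cast

theorem quad_ok {S : Finset (Fin 6)} (h3 : 3 ≤ S.card) (hc : ZConvex S) (he : ZEmpty S)
    (hd : ∀ i ∈ S, ∀ j ∈ S, i ≠ j → ZEdge i j ∨ ZDiag S i j) :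
    (∀ p ∈ S.map vE, hex.IsVtx p) ∧ 3 ≤ (S.map vE).card ∧ InConvexPosition (S.map vE) ∧
      (∀ p q, IsHullEdgeOf (S.map vE) p q → D0.IsEdgeOrDiag s(p, q)) ∧
      (∀ i, hex.vtx i ∉ interior (convexHull ℝ (↑(S.map vE) : Set Pt))) := by
  refine ⟨?_, ?_, zconvex hc, ?_, ?_⟩
  · intro p hp
    obtain ⟨i, _, rfl⟩ := Finset.mem_map.1 hp
    exact ⟨i, rfl⟩
  · rwa [Finset.card_map]
  · rintro p q ⟨hp, hq, hne, hf⟩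
    obtain ⟨i, hi, rfl⟩ := Finset.mem_map.1 hp
    obtain ⟨j, hj, rfl⟩ := Finset.mem_map.1 hq
    have hij : i ≠ j := by rintro rfl; exact hne rfl
    rcases hd i hi j hj hij with h | h
    · exact zedge h
    · exfalso
      obtain ⟨x, hx⟩ := openSegment_nonempty' (v i) (v j)
      exact (hf (openSegment_subset_segment _ _ _ hx)).2 (zdiag hi hj h hx)
  · intro i
    have := zempty he i
    rw [Finset.coe_map]
    exact this

theorem D0_ps : D0.IsPsFlippableSet (Finset.map dgE {0, 2}) := by
  refine ⟨Finset.map_subset_map.2 (by decide),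
    {Finset.map vE {0, 1, 2, 3}, Finset.map vE {0, 3, 4, 5}}, ?_, ?_, ?_⟩
  · intro Q hQ
    rw [Finset.mem_insert, Finset.mem_singleton] at hQ
    rcases hQ with rfl | rfl
    · exact quad_ok (by decide) (by decide +kernel) (by decide +kernel) (by decide +kernel)
    · exact quad_ok (by decide) (by decide +kernel) (by decide +kernel) (by decide +kernel)
  · have key : interior (convexHull ℝ (↑(Finset.map vE {0, 1, 2, 3}) : Set Pt)) ∩
        interior (convexHull ℝ (↑(Finset.map vE {0, 3, 4, 5}) : Set Pt)) = ∅ := by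
      rw [Set.eq_empty_iff_forall_notMem]
      rintro x ⟨h1, h2⟩
      have h03 : v 0 ≠ v 3 := fun h => by simpa using v_inj h
      have k1 := interior_orient h03.symm (by
        intro q hq
        obtain ⟨j, hj, rfl⟩ := Finset.mem_map.1 (Finset.mem_coe.1 hq)
        change 0 ≤ orient (v 3) (v 0) (v j)
        rw [orient_v]
        have : ∀ j ∈ ({0, 1, 2, 3} : Finset (Fin 6)), 0 ≤ orZ 3 0 j := by decide
        exact_mod_cast this j hj) h1
      have k2 := interior_orient h03 (by
        intro q hq
        obtain ⟨j, hj, rfl⟩ := Finset.mem_map.1 (Finset.mem_coe.1 hq)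
        change 0 ≤ orient (v 0) (v 3) (v j)
        rw [orient_v]
        have : ∀ j ∈ ({0, 3, 4, 5} : Finset (Fin 6)), 0 ≤ orZ 0 3 j := by decide
        exact_mod_cast this j hj) h2
      have : orient (v 3) (v 0) x = - orient (v 0) (v 3) x := by simp only [orient]; ring
      linarith
    intro Q hQ Q' hQ' hne
    rw [Finset.mem_insert, Finset.mem_singleton] at hQ hQ'
    rcases hQ with rfl | rfl <;> rcases hQ' with rfl | rfl
    · exact absurd rfl hne
    · exact key
    · rw [Set.inter_comm]; exact key
    · exact absurd rfl hne
  · intro e he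
    obtain ⟨k, hk, rfl⟩ := Finset.mem_map.1 he
    rw [Finset.mem_insert, Finset.mem_singleton] at hk
    rcases hk with rfl | rfl
    · refine ⟨_, Finset.mem_insert_self _ _, v 0, Finset.mem_map.2 ⟨0, by decide, rfl⟩,
        v 2, Finset.mem_map.2 ⟨2, by decide, rfl⟩, rfl, ?_⟩
      exact zdiag (by decide) (by decide) (by decide +kernel)
    · refine ⟨_, Finset.mem_insert_of_mem (Finset.mem_singleton_self _), v 0,
        Finset.mem_map.2 ⟨0, by decide, rfl⟩,
        v 4, Finset.mem_map.2 ⟨4, by decide, rfl⟩, rfl, ?_⟩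
      exact zdiag (by decide) (by decide) (by decide +kernel)

theorem F_flip : ∀ e ∈ Finset.map dgE {0, 2}, D0.IsFlippable e := by
  intro e he
  obtain ⟨k, hk, rfl⟩ := Finset.mem_map.1 he
  exact flip_all k ((by decide : ({0, 2} : Finset (Fin 6)) ⊆ {0, 1, 2}) hk)

theorem F_card : (Finset.map dgE {0, 2}).card = 2 := by rw [Finset.card_map]; rfl

/-- there is a simple polygon with a triangulation having exactly
`k = 3` flippable diagonals, `l = 2` of which form a ps-flippable set, and with
exactly `5 = 2² · (5/4)¹` triangulations; consequently `c_gon ≤ 5/4`. -/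
theorem statement10 :
    (∃ (P : SimplePolygon) (D : PolyTriangulation P) (F : Finset (Sym2 Pt)),
      D.flipCount = 3 ∧ D.IsPsFlippableSet F ∧ (∀ e ∈ F, D.IsFlippable e) ∧
      F.card = 2 ∧ polyTriCount P = 5) ∧
    ∀ c : ℝ, 0 < c →
      (∀ (P : SimplePolygon) (D : PolyTriangulation P) (F : Finset (Sym2 Pt)),
        D.IsPsFlippableSet F → (∀ e ∈ F, D.IsFlippable e) →
        (2 : ℝ) ^ F.card * c ^ (D.flipCount - F.card) ≤ (polyTriCount P : ℝ)) →
      c ≤ 5 / 4 := by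
  refine ⟨⟨hex, D0, Finset.map dgE {0, 2}, D0_flipCount, D0_ps, F_flip, F_card, hex_count⟩, ?_⟩
  intro c _ h
  have := h hex D0 _ D0_ps F_flip
  rw [D0_flipCount, F_card, hex_count] at this
  norm_num at this
  linarith

end
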